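/- arXiv:0902.3637 — 2 statements merged into one kernel-verified Lean document; each statement's English description precedes it below -/
import Mathlib

section
/- Let n₀ be a positive integer, let w = w_1⋯w_k be a word with w_i ≠ n₀ for all i, let m ≥ 0, and let S(w) be the set of all words obtained by inserting m copies of the letter n₀ into w. Then Σ_{w'∈S(w)} q^{maj(w')} = q^{maj(w)} · [k+m choose m]_q as polynomials in q. -/
open Polynomial

namespace MoonPolyomino

/-- A cell `(r, c)` of `ℤ²`: `r` is the row index (rows increase downwards)
and `c` is the column index (columns increase to the right). -/
abbrev Cell : Type := ℤ × ℤ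

/-- The set of (indices of) rows of a polyomino. -/
def rowSet (P : Finset Cell) : Finset ℤ := P.image Prod.fst

/-- The set of (indices of) columns of a polyomino. -/
def colSet (P : Finset Cell) : Finset ℤ := P.image Prod.snd

/-- The length of row `r` of `P`. -/
def rowLen (P : Finset Cell) (r : ℤ) : ℕ := (P.filter fun x => x.1 = r).card

/-- The length of column `c` of `P`. -/
def colLen (P : Finset Cell) (c : ℤ) : ℕ := (P.filter fun x => x.2 = c).card

def RowConvex (P : Finset Cell) : Prop :=
  ∀ r c₁ c₂ c : ℤ, (r, c₁) ∈ P → (r, c₂) ∈ P → c₁ ≤ c → c ≤ c₂ → (r, c) ∈ P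

def ColConvex (P : Finset Cell) : Prop :=
  ∀ c r₁ r₂ r : ℤ, (r₁, c) ∈ P → (r₂, c) ∈ P → r₁ ≤ r → r ≤ r₂ → (r, c) ∈ P

/-- Any two columns are comparable (the rows met by one form a subset of those met
by the other). -/
def IntersectionFree (P : Finset Cell) : Prop :=
  ∀ c₁ c₂ : ℤ, (∀ r : ℤ, (r, c₁) ∈ P → (r, c₂) ∈ P) ∨ (∀ r : ℤ, (r, c₂) ∈ P → (r, c₁) ∈ P)

/-- A moon polyomino: a convex intersection-free polyomino. -/
def IsMoon (P : Finset Cell) : Prop := RowConvex P ∧ ColConvex P ∧ IntersectionFree P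

/-- A left-aligned stack polyomino: all rows have their leftmost cell in the same column. -/
def LeftAligned (P : Finset Cell) : Prop := ∃ c₀ : ℤ, ∀ x ∈ P, c₀ ≤ x.2 ∧ (x.1, c₀) ∈ P

/-- A top-aligned stack polyomino: all columns have their topmost cell in the same row. -/
def TopAligned (P : Finset Cell) : Prop := ∃ r₀ : ℤ, ∀ x ∈ P, r₀ ≤ x.1 ∧ (r₀, x.2) ∈ P

/-- A 01-filling of `P`, identified with its set `M` of 1-cells: at most one 1 in each row. -/
def IsFilling (P M : Finset Cell) : Prop :=
  M ⊆ P ∧ ∀ x ∈ M, ∀ y ∈ M, x.1 = y.1 → x = y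

open scoped Classical in
/-- `F(𝓜, s; A)`: the 01-fillings of `P` in which column `c` contains exactly `s c` ones
and whose empty rows are exactly the rows in `A`. -/
noncomputable def FillSet (P : Finset Cell) (s : ℤ → ℕ) (A : Finset ℤ) :
    Finset (Finset Cell) :=
  P.powerset.filter fun M =>
    (∀ x ∈ M, ∀ y ∈ M, x.1 = y.1 → x = y) ∧
    (∀ c ∈ colSet P, (M.filter fun x => x.2 = c).card = s c) ∧
    (∀ r ∈ rowSet P, (r ∈ A ↔ ∀ x ∈ M, x.1 ≠ r))

open scoped Classical in
/-- `ne(M)`: the number of north-east chains, i.e. pairs of 1-cells, one strictly above and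
strictly to the right of the other, such that the smallest rectangle containing both lies
in `P`.  In a pair `p`, `p.1` is the lower-left cell and `p.2` the upper-right one. -/
noncomputable def neP (P M : Finset Cell) : ℕ :=
  ((M ×ˢ M).filter fun p =>
      p.2.1 < p.1.1 ∧ p.1.2 < p.2.2 ∧
      ∀ a b : ℤ, p.2.1 ≤ a → a ≤ p.1.1 → p.1.2 ≤ b → b ≤ p.2.2 → (a, b) ∈ P).card

open scoped Classical in
/-- The descent statistic of a rectangular filling `M`: the number of pairs of 1-cells lying
in consecutive nonempty rows and forming a north-east chain (`p.1` is the cell in the upper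
of the two rows, `p.2` the one in the next nonempty row below it). -/
noncomputable def desR (M : Finset Cell) : ℕ :=
  ((M ×ˢ M).filter fun p =>
      p.1.1 < p.2.1 ∧ p.2.2 < p.1.2 ∧ ∀ z ∈ M, ¬ (p.1.1 < z.1 ∧ z.1 < p.2.1)).card

/-- The major index of a rectangular filling `M`: the sum, over the nonempty rows `r`,
of the descent statistic of the restriction of `M` to row `r` and the rows above it. -/
noncomputable def majR (M : Finset Cell) : ℕ :=
  ∑ y ∈ M, desR (M.filter fun x => x.1 ≤ y.1)

/-- `R` is a (nonempty) combinatorial rectangle. -/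
def IsRect (R : Finset Cell) : Prop :=
  ∃ r₁ r₂ c₁ c₂ : ℤ, r₁ ≤ r₂ ∧ c₁ ≤ c₂ ∧ R = Finset.Icc r₁ r₂ ×ˢ Finset.Icc c₁ c₂

/-- `R` is a maximal rectangle contained in `P`. -/
def IsMaxRect (P R : Finset Cell) : Prop :=
  IsRect R ∧ R ⊆ P ∧ ∀ R' : Finset Cell, IsRect R' → R' ⊆ P → R ⊆ R' → R' = R

open scoped Classical in
/-- The set of maximal rectangles contained in `P`. -/
noncomputable def maxRects (P : Finset Cell) : Finset (Finset Cell) :=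
  P.powerset.filter fun R => IsMaxRect P R

/-- The height (number of rows) of a rectangle. -/
def nRows (R : Finset Cell) : ℕ := (R.image Prod.fst).card

open scoped Classical in
/-- The major index of a filling `M` of a moon polyomino `P`:
`maj(M) = Σᵢ maj(Rᵢ) − Σᵢ maj(Rᵢ ∩ Rᵢ₊₁)`, where `R₁, …, R_r` are the restrictions of `M`
to the maximal rectangles of `P` listed in increasing order of height (in a moon polyomino
the maximal rectangles have pairwise distinct heights; the consecutive pairs are exactly
the pairs of maximal rectangles with no maximal rectangle of intermediate height). -/
noncomputable def majP (P M : Finset Cell) : ℕ :=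
  (∑ R ∈ maxRects P, majR (M ∩ R)) -
    ∑ p ∈ (maxRects P ×ˢ maxRects P).filter
        (fun p => nRows p.1 < nRows p.2 ∧
          ∀ T ∈ maxRects P, ¬ (nRows p.1 < nRows T ∧ nRows T < nRows p.2)),
      majR (M ∩ p.1 ∩ p.2)

/-- `c` belongs to the right part `Right(𝓜)` of `P`: every column strictly to its right
is at most as long as `c`. -/
def InRightPart (P : Finset Cell) (c : ℤ) : Prop :=
  ∀ d ∈ colSet P, c < d → colLen P d ≤ colLen P c

/-- The total order `≺` on the columns of a moon polyomino. -/
def colPrec (P : Finset Cell) (c d : ℤ) : Prop :=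
  colLen P c < colLen P d ∨
    (colLen P c = colLen P d ∧
      ((¬ InRightPart P c ∧ InRightPart P d) ∨
       (¬ InRightPart P c ∧ ¬ InRightPart P d ∧ c < d) ∨
       (InRightPart P c ∧ InRightPart P d ∧ d < c)))

open scoped Classical in
/-- `h_c = |c| − a_c − Σ_{d ≺ c} s_d`, where `a_c` is the number of rows of `A`
meeting column `c`. -/
noncomputable def hVal (P : Finset Cell) (s : ℤ → ℕ) (A : Finset ℤ) (c : ℤ) : ℤ :=
  (colLen P c : ℤ) - ((A.filter fun r => (r, c) ∈ P).card : ℤ)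
    - ∑ d ∈ (colSet P).filter (fun d => colPrec P d c), (s d : ℤ)

open scoped Classical in
/-- The Gaussian binomial coefficient
`[h choose s]_q = Σ_{0 ≤ i₁ ≤ ⋯ ≤ i_s ≤ h−s} q^{i₁+⋯+i_s}` as a polynomial in `q = X`. -/
noncomputable def gaussBinom (h : ℤ) (s : ℕ) : Polynomial ℤ :=
  ∑ f ∈ (Fintype.piFinset fun _ : Fin s => Finset.Icc (0 : ℤ) (h - s)).filter
      (fun f => Monotone f),
    Polynomial.X ^ (∑ i, f i).toNat

/-- The major index of a word: `maj(w) = Σ_{i ∈ Des(w)} i` (positions are 1-based). -/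
def majW (w : List ℕ) : ℕ :=
  ∑ i ∈ Finset.range (w.length - 1), if w.getD (i + 1) 0 < w.getD i 0 then i + 1 else 0

/-- The descent number of a word. -/
def desW (w : List ℕ) : ℕ :=
  ∑ i ∈ Finset.range (w.length - 1), if w.getD (i + 1) 0 < w.getD i 0 then 1 else 0

/-- `w'` is obtained from `w` by inserting `m` copies of the letter `a` (where `a` does not
occur in `w`): `w'` has length `k + m`, exactly `m` letters equal to `a`, and its
subsequence of letters different from `a` is `w`. -/
def IsInsertion (w : List ℕ) (a m : ℕ) (w' : List ℕ) : Prop :=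
  w'.length = w.length + m ∧ w'.count a = m ∧ w'.filter (fun x => decide (x ≠ a)) = w

open scoped Classical in
/-- The weakly increasing `m`-tuples `0 ≤ i₁ ≤ ⋯ ≤ i_m ≤ k`. -/
noncomputable def monoTuples (m k : ℕ) : Finset (Fin m → ℕ) :=
  (Fintype.piFinset fun _ : Fin m => Finset.range (k + 1)).filter fun f => Monotone f


/-- Reversed major index. -/
def rmaj : List ℕ → ℕ
  | [] => 0
  | [_] => 0
  | x :: y :: l => rmaj (y :: l) + if x < y then l.length + 1 else 0

theorem majW_append (l : List ℕ) (y x : ℕ) :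
    majW (l ++ [y] ++ [x]) = majW (l ++ [y]) + if x < y then l.length + 1 else 0 := by
  unfold majW
  simp only [List.length_append, List.length_cons, List.length_nil, Nat.add_sub_cancel, zero_add]
  rw [Finset.sum_range_succ]
  congr 1
  · apply Finset.sum_congr rfl
    intro i hi
    have hi := Finset.mem_range.1 hi
    rw [List.getD_append _ _ _ (i+1) (by simp; omega), List.getD_append _ _ _ i (by simp; omega)]
  · simp [List.getD_eq_getElem?_getD]

theorem majW_reverse (l : List ℕ) : majW l.reverse = rmaj l := by
  induction l with
  | nil => simp [majW, rmaj]
  | cons x t ih =>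
    cases t with
    | nil => simp [majW, rmaj]
    | cons y l =>
      rw [rmaj, ← ih, List.reverse_cons, List.reverse_cons, majW_append]
      simp

/-- Insertions into reversed words. -/
def ins (a : ℕ) : List ℕ → ℕ → Finset (List ℕ)
  | [], m => {List.replicate m a}
  | x :: r, 0 => {x :: r}
  | x :: r, m + 1 => (ins a r (m + 1)).image (List.cons x) ∪ (ins a (x :: r) m).image (List.cons a)

theorem mem_ins (a : ℕ) (r : List ℕ) (m : ℕ) (hr : ∀ x ∈ r, x ≠ a) (l : List ℕ) :
    l ∈ ins a r m ↔ l.count a = m ∧ l.filter (fun x => decide (x ≠ a)) = r := by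
  induction l generalizing r m with
  | nil =>
    rcases r with _ | ⟨x, r⟩ <;> rcases m with _ | m <;> simp [ins, List.replicate_succ]
  | cons b l ih =>
    rcases r with _ | ⟨x, r⟩
    · have := fun m => ih [] m (by simp)
      rcases m with _ | m
      · have h0 := this 0
        simp only [ins, List.replicate_zero, Finset.mem_singleton] at h0
        simp only [ins, List.replicate_zero, Finset.mem_singleton]
        by_cases hb : b = a <;> simp [hb]
      · have h0 := this m
        simp only [ins, Finset.mem_singleton] at h0
        simp only [ins, Finset.mem_singleton, List.replicate_succ]
        by_cases hb : b = a
        · subst hb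
          simp [h0]
        · simp [hb]
    · have hx : x ≠ a := hr x (by simp)
      have hr' : ∀ y ∈ r, y ≠ a := fun y hy => hr y (by simp [hy])
      rcases m with _ | m
      · simp only [ins, Finset.mem_singleton]
        by_cases hb : b = a
        · subst hb
          simp [hx.symm]
        · simp only [List.cons.injEq, List.filter_cons, hb, List.count_cons]
          simp only [ne_eq, not_false_eq_true, decide_true, if_true, beq_iff_eq, hb, if_false,
            add_zero, List.cons.injEq]
          constructor
          · rintro ⟨rfl, rfl⟩
            refine ⟨List.count_eq_zero.2 fun h => hr' _ h rfl, rfl, ?_⟩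
            rw [List.filter_eq_self]
            intro y hy; simpa using hr' y hy
          · rintro ⟨h1, h2, h3⟩
            refine ⟨h2, ?_⟩
            rw [← h3]
            symm
            rw [List.filter_eq_self]
            intro y hy
            have := List.count_eq_zero.1 h1
            simp
            rintro rfl
            exact this hy
      · simp only [ins, Finset.mem_union, Finset.mem_image, List.cons.injEq]
        have e1 : (∃ t ∈ ins a r (m+1), x = b ∧ t = l) ↔ x = b ∧ l ∈ ins a r (m+1) := by
          constructor
          · rintro ⟨t, h, h1, rfl⟩; exact ⟨h1, h⟩
          · rintro ⟨h1, h⟩; exact ⟨_, h, h1, rfl⟩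
        have e2 : (∃ t ∈ ins a (x :: r) m, a = b ∧ t = l) ↔ a = b ∧ l ∈ ins a (x :: r) m := by
          constructor
          · rintro ⟨t, h, h1, rfl⟩; exact ⟨h1, h⟩
          · rintro ⟨h1, h⟩; exact ⟨_, h, h1, rfl⟩
        rw [e1, e2, ih r (m+1) hr', ih (x :: r) m hr]
        by_cases hb : b = a
        · subst hb
          simp [hx]
        · simp [hb, Ne.symm hb, List.count_cons]
          tauto

theorem length_of_mem_ins (a : ℕ) (r : List ℕ) (m : ℕ) (l : List ℕ) (h : l ∈ ins a r m) :
    l.length = r.length + m := by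
  fun_induction ins a r m generalizing l with
  | case1 m => simp at h; simp [h]
  | case2 x r => simp at h; simp [h]
  | case3 x r m ih1 ih2 =>
    simp only [Finset.mem_union, Finset.mem_image] at h
    rcases h with ⟨t, h, rfl⟩ | ⟨t, h, rfl⟩
    · have := ih1 t h; simp; omega
    · have := ih2 t h; simp at this ⊢; omega

/-- Recursive Gaussian binomial. -/
noncomputable def G (k m : ℕ) : Polynomial ℤ := gaussBinom ((k + m : ℕ) : ℤ) m

theorem G_zero_right (k : ℕ) : G k 0 = 1 := by
  unfold G gaussBinom
  rw [Finset.filter_true_of_mem]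
  · simp
  · intro f _ i; exact i.elim0

theorem G_zero_left (m : ℕ) : G 0 m = 1 := by
  unfold G gaussBinom
  rw [show (((0 + m : ℕ) : ℤ) - m) = 0 by simp]
  rw [Finset.sum_eq_single (fun _ => 0)]
  · simp
  · intro f hf hne
    exfalso; apply hne
    simp at hf
    exact hf.1
  · intro h
    exfalso; apply h
    simp [monotone_const]

theorem G_pascal (k m : ℕ) : G (k+1) (m+1) = G k (m+1) + X ^ (k+1) * G (k+1) m := by
  classical
  unfold G gaussBinom
  rw [show (((k + 1 + (m+1) : ℕ) : ℤ) - (m+1 : ℕ)) = k + 1 by push_cast; ring,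
    show (((k + (m+1) : ℕ) : ℤ) - (m+1 : ℕ)) = k by push_cast; ring,
    show (((k + 1 + m : ℕ) : ℤ) - (m : ℕ)) = k + 1 by push_cast; ring]
  rw [← Finset.sum_filter_add_sum_filter_not _ (fun f : Fin (m+1) → ℤ => f (Fin.last m) ≤ k)]
  congr 1
  · apply Finset.sum_congr _ (fun _ _ => rfl)
    ext f
    simp only [Finset.mem_filter, Fintype.mem_piFinset, Finset.mem_Icc]
    constructor
    · rintro ⟨⟨h1, h2⟩, h3⟩
      exact ⟨fun i => ⟨(h1 i).1, (h2 (Fin.le_last i)).trans h3⟩, h2⟩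
    · rintro ⟨h1, h2⟩
      exact ⟨⟨fun i => ⟨(h1 i).1, by have := (h1 i).2; omega⟩, h2⟩, (h1 _).2⟩
  · rw [Finset.mul_sum]
    symm
    apply Finset.sum_bij' (fun f _ => (Fin.snoc f ((k : ℤ) + 1) : Fin (m+1) → ℤ))
      (fun f _ => Fin.init f)
    · intro f hf
      simp only [Finset.mem_filter, Fintype.mem_piFinset, Finset.mem_Icc] at hf ⊢
      refine ⟨⟨?_, ?_⟩, by simp⟩
      · intro i
        refine Fin.lastCases ?_ (fun i => ?_) i
        · simp; omega
        · simpa using hf.1 i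
      · intro i j
        refine Fin.lastCases ?_ (fun j => ?_) j
        · refine Fin.lastCases ?_ (fun i => ?_) i
          · simp
          · intro _; simpa using (hf.1 i).2
        · refine Fin.lastCases ?_ (fun i => ?_) i
          · intro h
            exact absurd (Fin.castSucc_lt_last j) (not_lt.2 h)
          · intro h
            simpa using hf.2 (by simpa using h)
    · intro f hf
      simp only [Finset.mem_filter, Fintype.mem_piFinset, Finset.mem_Icc] at hf ⊢
      exact ⟨fun i => hf.1.1 _, fun i j h => hf.1.2 (by simpa using h)⟩
    · intro f hf; simp
    · intro f hf
      simp only [Finset.mem_filter, Fintype.mem_piFinset, Finset.mem_Icc] at hf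
      have : (k : ℤ) + 1 = f (Fin.last m) := by
        have := (hf.1.1 (Fin.last m)).2
        have := hf.2
        omega
      rw [this]; exact Fin.snoc_init_self f
    · intro f hf
      simp only [Finset.mem_filter, Fintype.mem_piFinset, Finset.mem_Icc] at hf
      rw [← pow_add]
      congr 1
      rw [Fin.sum_univ_castSucc]
      simp only [Fin.snoc_castSucc, Fin.snoc_last]
      have : 0 ≤ ∑ i, f i := Finset.sum_nonneg fun i _ => (hf.1 i).1
      omega

theorem G_pascal' (k m : ℕ) : G (k+1) (m+1) = X ^ (m+1) * G k (m+1) + G (k+1) m := by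
  induction k generalizing m with
  | zero =>
    induction m with
    | zero => rw [G_pascal]; simp [G_zero_left, G_zero_right]; ring
    | succ m ih =>
      rw [G_pascal]
      rw [G_zero_left] at ih ⊢
      have h2 := G_pascal 0 m
      rw [G_zero_left] at h2
      linear_combination (X : Polynomial ℤ) * ih - h2
  | succ k ihk =>
    induction m with
    | zero =>
      have h1 := G_pascal (k+1) 0
      have h2 := G_pascal k 0
      have h3 := ihk 0
      simp only [G_zero_right] at *
      rw [h1]
      linear_combination h3 - X * h2
    | succ m ihm =>
      have h1 := G_pascal (k+1) (m+1)
      have h2 := G_pascal k (m+1)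
      have h3 := ihk (m+1)
      have h4 := G_pascal (k+1) m
      linear_combination h1 + h3 - X^(m+2) * h2 + X^(k+2) * ihm - h4

theorem rmaj_replicate (a z m : ℕ) :
    rmaj (z :: List.replicate m a) = if z < a then m else 0 := by
  induction m generalizing z with
  | zero => simp [rmaj]
  | succ m ih =>
    rw [List.replicate_succ, rmaj, ih]
    simp

theorem main_H (a : ℕ) (r : List ℕ) (m : ℕ) (hr : ∀ x ∈ r, x ≠ a) (z : ℕ) :
    ∑ l ∈ ins a r m, (X : Polynomial ℤ) ^ rmaj (z :: l)
      = X ^ (rmaj (z :: r) + if z < a then m else 0) * G r.length m := by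
  fun_induction ins a r m generalizing z with
  | case1 m => simp [rmaj_replicate, G_zero_left, rmaj]
  | case2 x r => simp [G_zero_right]
  | case3 x r m ih1 ih2 =>
    have hx : x ≠ a := hr x (by simp)
    have hr' : ∀ y ∈ r, y ≠ a := fun y hy => hr y (by simp [hy])
    rw [Finset.sum_union, Finset.sum_image (by simp), Finset.sum_image (by simp)]
    · have e1 : ∑ l ∈ ins a r (m+1), (X : Polynomial ℤ) ^ rmaj (z :: x :: l)
          = X ^ (if z < x then r.length + m + 2 else 0) *
            ∑ l ∈ ins a r (m+1), (X : Polynomial ℤ) ^ rmaj (x :: l) := by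
        rw [Finset.mul_sum]
        apply Finset.sum_congr rfl
        intro l hl
        rw [rmaj, length_of_mem_ins _ _ _ _ hl, ← pow_add, add_comm]; rfl
      have e2 : ∑ l ∈ ins a (x :: r) m, (X : Polynomial ℤ) ^ rmaj (z :: a :: l)
          = X ^ (if z < a then r.length + m + 2 else 0) *
            ∑ l ∈ ins a (x :: r) m, (X : Polynomial ℤ) ^ rmaj (a :: l) := by
        rw [Finset.mul_sum]
        apply Finset.sum_congr rfl
        intro l hl
        rw [rmaj, length_of_mem_ins _ _ _ _ hl, ← pow_add, add_comm]
        simp only [List.length_cons]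
        rw [show r.length + 1 + m + 1 = r.length + m + 2 by ring]
      rw [e1, e2, ih1 hr', ih2 hr]
      simp only [rmaj, List.length_cons, lt_irrefl, if_false, Nat.succ_eq_add_one]
      have p1 := G_pascal r.length m
      have p2 := G_pascal' r.length m
      rcases lt_or_gt_of_ne hx with h | h
      · by_cases h1 : z < x
        · have : z < a := by omega
          simp only [h, h1, this, if_true, not_lt.2 h.le, if_false]
          rw [p2]; ring
        · by_cases h2 : z < a
          · simp only [h, h1, h2, if_true, not_lt.2 h.le, if_false]
            rw [p1]; ring
          · simp only [h, h1, h2, if_true, not_lt.2 h.le, if_false]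
            rw [p2]; ring
      · by_cases h1 : z < x
        · by_cases h2 : z < a
          · simp only [h, h1, h2, if_true, not_lt.2 (le_of_lt h), if_false]
            rw [p1]; ring
          · simp only [h, h1, h2, if_true, not_lt.2 (le_of_lt h), if_false]
            rw [p2]; ring
        · have : ¬ z < a := by omega
          simp only [h, h1, this, if_true, not_lt.2 (le_of_lt h), if_false]
          rw [p1]; ring
    · rw [Finset.disjoint_left]
      intro l h1 h2
      simp only [Finset.mem_image] at h1 h2
      obtain ⟨t, _, rfl⟩ := h1
      obtain ⟨s, _, h⟩ := h2
      simp at h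
      exact hx h.1.symm

theorem rmaj_cons_big (z : ℕ) (l : List ℕ) (h : ∀ x ∈ l, x ≤ z) : rmaj (z :: l) = rmaj l := by
  cases l with
  | nil => rfl
  | cons y l =>
    have := h y (by simp)
    simp [rmaj, not_lt.2 this]

/-- **Theorem (STATEMENT 8, Remark 4.7).** Let `w` be a word of positive integers of
length `k` none of whose letters equals `n₀`, and let `S(w)` be the set of words obtained
by inserting `m` copies of `n₀` into `w`.  Then
`Σ_{w' ∈ S(w)} q^{maj(w')} = q^{maj(w)} [k+m choose m]_q`. -/
theorem insertion_maj_genfun_general (n₀ : ℕ) (hn₀ : 0 < n₀) (w : List ℕ)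
    (hpos : ∀ x ∈ w, 0 < x) (hw : ∀ x ∈ w, x ≠ n₀) (m : ℕ)
    (S : Finset (List ℕ)) (hS : ∀ l : List ℕ, l ∈ S ↔ IsInsertion w n₀ m l) :
    ∑ w' ∈ S, (Polynomial.X : Polynomial ℤ) ^ majW w'
      = Polynomial.X ^ majW w * gaussBinom ((w.length + m : ℕ) : ℤ) m := by
  have hr : ∀ x ∈ w.reverse, x ≠ n₀ := fun x hx => hw x (by simpa using hx)
  have hle : ∀ x ∈ w, x ≤ n₀ + w.sum := fun x hx => by
    have := List.le_sum_of_mem hx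
    omega
  have key := main_H n₀ w.reverse m hr (n₀ + w.sum)
  rw [rmaj_cons_big _ _ (fun x hx => hle x (by simpa using hx)), ← majW_reverse,
    List.reverse_reverse, if_neg (by omega), add_zero, List.length_reverse] at key
  rw [show gaussBinom ((w.length + m : ℕ) : ℤ) m = G w.length m from rfl, ← key]
  have mem : ∀ l, l ∈ S ↔ l.reverse ∈ ins n₀ w.reverse m := by
    intro l
    rw [hS, mem_ins _ _ _ hr, List.count_reverse, List.filter_reverse, List.reverse_inj, IsInsertion]
    constructor
    · rintro ⟨_, h⟩; exact h
    · intro h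
      refine ⟨?_, h⟩
      have h3 := length_of_mem_ins n₀ w.reverse m l.reverse (by
        rw [mem_ins _ _ _ hr, List.count_reverse, List.filter_reverse, List.reverse_inj]; exact h)
      simpa using h3
  refine Finset.sum_bij' (fun l _ => l.reverse) (fun l _ => l.reverse) ?_ ?_ ?_ ?_ ?_
  · intro l hl; exact (mem l).1 hl
  · intro l hl; rw [mem, List.reverse_reverse]; exact hl
  · simp
  · simp
  · intro l hl
    rw [rmaj_cons_big, ← majW_reverse, List.reverse_reverse]
    intro x hx
    by_cases hxa : x = n₀
    · omega
    · apply hle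
      have := ((hS l).1 hl).2.2
      rw [← this]
      simp at hx
      simp [hx, hxa]

end MoonPolyomino
end

section
/- Let n be a positive integer, let w = w_1⋯w_k (k ≥ 1) be a word with w_i < n for all i, and let t = des(w). Define the descent sequence a_1,…,a_{k+1} by a_i = maj(w^{(i)}) − maj(w), where w^{(i)} = w_1⋯w_{i−1} n w_i⋯w_k. Then a_1 = t+1, a_{k+1} = 0, the sequence a_1,…,a_{k+1} contains each of the values 0,1,…,k exactly once, the entries with value at most t+1 appear in strictly decreasing order, and the entries with value at least t+2 appear in strictly increasing order; i.e., a_1,…,a_{k+1} is a shuffle of the sequences t+1, t, …, 1, 0 and t+2, t+3, …, k beginning with t+1 and ending with 0. -/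
open Polynomial

namespace MoonPolyomino

/-- descent indicator -/
def dI (w : List ℕ) (i : ℕ) : ℕ := if w.getD (i + 1) 0 < w.getD i 0 then 1 else 0

/-- number of descents at index at least j -/
def dTail (w : List ℕ) (j : ℕ) : ℕ := ∑ i ∈ Finset.range (w.length - 1 - j), dI w (j + i)

lemma dI_le (w : List ℕ) (i : ℕ) : dI w i ≤ 1 := by
  unfold dI; split_ifs <;> omega

lemma majW_eq (w : List ℕ) :
    majW w = ∑ i ∈ Finset.range (w.length - 1), dI w i * (i + 1) := by
  unfold majW dI
  apply Finset.sum_congr rfl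
  intro i _
  split_ifs <;> simp

lemma dTail_zero (w : List ℕ) : dTail w 0 = desW w := by
  simp [dTail, desW, dI]

lemma dTail_succ (w : List ℕ) (j : ℕ) (h : j + 1 < w.length) :
    dTail w j = dI w j + dTail w (j + 1) := by
  unfold dTail
  obtain ⟨l, hl⟩ : ∃ l, w.length = j + 2 + l := ⟨w.length - (j + 2), by omega⟩
  rw [show w.length - 1 - j = l + 1 by omega, show w.length - 1 - (j + 1) = l by omega,
    Finset.sum_range_succ', add_comm]
  congr 1
  apply Finset.sum_congr rfl
  intro i _
  congr 1
  omega

lemma dTail_le (w : List ℕ) (j : ℕ) : dTail w j ≤ w.length - 1 - j := by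
  unfold dTail
  calc _ ≤ ∑ i ∈ Finset.range (w.length - 1 - j), 1 := Finset.sum_le_sum fun i _ => dI_le _ _
    _ = _ := by simp

lemma getD_ins_lt (w : List ℕ) (n j i : ℕ) (h : i < j) :
    (w.insertIdx j n).getD i 0 = w.getD i 0 := by
  simp [List.getD_eq_getElem?_getD, List.getElem?_insertIdx, h]

lemma getD_ins_eq (w : List ℕ) (n j : ℕ) (h : j ≤ w.length) :
    (w.insertIdx j n).getD j 0 = n := by
  simp [List.getD_eq_getElem?_getD, List.getElem?_insertIdx, h]

lemma getD_ins_gt (w : List ℕ) (n j i : ℕ) (h : j ≤ i) :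
    (w.insertIdx j n).getD (i + 1) 0 = w.getD i 0 := by
  have h1 : ¬ (i + 1 < j) := by omega
  have h2 : i + 1 ≠ j := by omega
  simp [List.getD_eq_getElem?_getD, List.getElem?_insertIdx, h1, h2]

lemma getD_lt (w : List ℕ) (n : ℕ) (hn : 0 < n) (hw : ∀ x ∈ w, x < n) (i : ℕ) :
    w.getD i 0 < n := by
  by_cases h : i < w.length
  · rw [List.getD_eq_getElem _ _ h]; exact hw _ (List.getElem_mem h)
  · rw [List.getD_eq_default _ _ (by omega)]; exact hn

/-- sum of the first j terms, before the insertion point -/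
lemma ins_head (w : List ℕ) (n : ℕ) (hn : 0 < n) (hw : ∀ x ∈ w, x < n) (j : ℕ)
    (h : j + 1 ≤ w.length) :
    ∑ i ∈ Finset.range (j + 1), dI (w.insertIdx (j + 1) n) i * (i + 1)
      = ∑ i ∈ Finset.range j, dI w i * (i + 1) := by
  rw [Finset.sum_range_succ]
  have h0 : dI (w.insertIdx (j + 1) n) j = 0 := by
    unfold dI
    rw [getD_ins_eq _ _ _ h, getD_ins_lt _ _ _ _ (Nat.lt_succ_self j), if_neg]
    have := getD_lt w n hn hw j
    omega
  rw [h0]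
  simp only [zero_mul, add_zero]
  apply Finset.sum_congr rfl
  intro i hi
  rw [Finset.mem_range] at hi
  unfold dI
  rw [getD_ins_lt _ _ _ _ (by omega), getD_ins_lt _ _ _ _ (by omega)]

lemma ins_tail (w : List ℕ) (n : ℕ) (hn : 0 < n) (hw : ∀ x ∈ w, x < n) (j l : ℕ)
    (h : w.length = j + 1 + l) :
    ∑ i ∈ Finset.range (l + 1), dI (w.insertIdx j n) (j + i) * (j + i + 1)
      = ∑ i ∈ Finset.range l, dI w (j + i) * (j + i + 1) + dTail w j + (j + 1) := by
  rw [Finset.sum_range_succ']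
  have h0 : dI (w.insertIdx j n) (j + 0) = 1 := by
    unfold dI
    rw [add_zero, getD_ins_eq _ _ _ (by omega), getD_ins_gt _ _ _ _ le_rfl, if_pos]
    exact getD_lt w n hn hw j
  rw [h0]
  unfold dTail
  rw [show w.length - 1 - j = l by omega, ← Finset.sum_add_distrib]
  congr 1
  · apply Finset.sum_congr rfl
    intro i _
    have : dI (w.insertIdx j n) (j + (i + 1)) = dI w (j + i) := by
      unfold dI
      rw [← add_assoc, getD_ins_gt _ _ _ _ (by omega), getD_ins_gt _ _ _ _ (by omega)]
    rw [this]; ring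
  · ring

lemma maj_ins_zero (w : List ℕ) (n : ℕ) (hn : 0 < n) (hk : 0 < w.length)
    (hw : ∀ x ∈ w, x < n) :
    majW (w.insertIdx 0 n) = majW w + (desW w + 1) := by
  obtain ⟨l, hl⟩ : ∃ l, w.length = 0 + 1 + l := ⟨w.length - 1, by omega⟩
  have := ins_tail w n hn hw 0 l hl
  rw [dTail_zero] at this
  rw [majW_eq, majW_eq, List.length_insertIdx_of_le_length (by omega),
    show w.length + 1 - 1 = l + 1 by omega, show w.length - 1 = l by omega]
  simp only [zero_add] at this
  omega

lemma maj_ins_last (w : List ℕ) (n : ℕ) (hn : 0 < n) (hk : 0 < w.length)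
    (hw : ∀ x ∈ w, x < n) :
    majW (w.insertIdx w.length n) = majW w := by
  obtain ⟨l, hl⟩ : ∃ l, w.length = l + 1 := ⟨w.length - 1, by omega⟩
  have := ins_head w n hn hw l (by omega)
  rw [majW_eq, majW_eq, List.length_insertIdx_of_le_length (by omega), hl,
    show l + 1 + 1 - 1 = l + 1 by omega, show l + 1 - 1 = l by omega]
  exact this

lemma maj_ins_mid (w : List ℕ) (n : ℕ) (hn : 0 < n) (hw : ∀ x ∈ w, x < n) (m : ℕ)
    (h : m + 1 < w.length) :
    majW (w.insertIdx (m + 1) n) + dI w m * (m + 1) = majW w + dTail w (m + 1) + (m + 2) := by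
  obtain ⟨l, hl⟩ : ∃ l, w.length = m + 1 + 1 + l := ⟨w.length - (m + 2), by omega⟩
  have h1 := ins_head w n hn hw m (by omega)
  have h2 := ins_tail w n hn hw (m + 1) l hl
  rw [majW_eq, majW_eq, List.length_insertIdx_of_le_length (by omega),
    show w.length + 1 - 1 = (m + 1) + (l + 1) by omega, show w.length - 1 = (m + 1) + l by omega,
    Finset.sum_range_add _ (m + 1) (l + 1), Finset.sum_range_add _ (m + 1) l, h1, h2,
    Finset.sum_range_succ _ m]
  ring

lemma dTail_anti (w : List ℕ) (i j : ℕ) (hij : i ≤ j) (h : j < w.length) :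
    dTail w j ≤ dTail w i ∧ dTail w i + i ≤ dTail w j + j := by
  induction j, hij using Nat.le_induction with
  | base => simp
  | succ j hj ih =>
    have := ih (by omega)
    have := dTail_succ w j h
    have := dI_le w j
    omega

/-- **Theorem (STATEMENT 10).** Let `w` be a nonempty word of length `k` of positive
integers, all `< n`, with `t = des(w)`, and let `a j = maj(w⁽ʲ⁺¹⁾) − maj(w)` for
`0 ≤ j ≤ k` (0-indexed insertion positions).  Then `a 0 = t + 1`, `a k = 0`, the sequence
`a 0, …, a k` contains each value `0, …, k` exactly once, its entries `≤ t + 1` appear in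
strictly decreasing order, and its entries `≥ t + 2` appear in strictly increasing order;
i.e. it is a shuffle of `t+1, t, …, 0` and `t+2, t+3, …, k` beginning with `t+1` and
ending with `0`. -/
theorem descent_sequence_shuffle (n : ℕ) (hn : 0 < n) (w : List ℕ)
    (hpos : ∀ x ∈ w, 0 < x) (hk : 0 < w.length) (hw : ∀ x ∈ w, x < n)
    (a : ℕ → ℕ) (ha : ∀ j ≤ w.length, a j = majW (w.insertIdx j n) - majW w) :
    a 0 = desW w + 1 ∧
    a w.length = 0 ∧
    (∀ v ≤ w.length, ∃! j, j ≤ w.length ∧ a j = v) ∧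
    (∀ j₁ j₂ : ℕ, j₁ < j₂ → j₂ ≤ w.length →
      a j₁ ≤ desW w + 1 → a j₂ ≤ desW w + 1 → a j₂ < a j₁) ∧
    (∀ j₁ j₂ : ℕ, j₁ < j₂ → j₂ ≤ w.length →
      desW w + 2 ≤ a j₁ → desW w + 2 ≤ a j₂ → a j₁ < a j₂) := by
  have hlast : a w.length = 0 := by
    rw [ha _ le_rfl, maj_ins_last w n hn hk hw]; omega
  have h0 : a 0 = desW w + 1 := by
    rw [ha _ (Nat.zero_le _), maj_ins_zero w n hn hk hw]; omega
  have hD0 := dTail_zero w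
  -- classification
  have hcl : ∀ j, j < w.length →
      (a j = dTail w j + 1 ∧ (j = 0 ∨ ∃ m, j = m + 1 ∧ dTail w m = dTail w j + 1)) ∨
      (a j = dTail w j + j + 1 ∧ ∃ m, j = m + 1 ∧ dTail w m = dTail w j) := by
    intro j hj
    rcases j with _ | m
    · left; exact ⟨by omega, Or.inl rfl⟩
    · have e1 := ha (m + 1) (by omega)
      have e2 := maj_ins_mid w n hn hw m hj
      have e3 := dTail_succ w m hj
      have e4 := dI_le w m
      rcases (show dI w m = 0 ∨ dI w m = 1 by omega) with e | e
      · right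
        rw [e] at e2 e3
        exact ⟨by omega, m, rfl, by omega⟩
      · left
        rw [e] at e2 e3
        exact ⟨by omega, Or.inr ⟨m, rfl, by omega⟩⟩
  have hle : ∀ j ≤ w.length, a j ≤ w.length := by
    intro j hj
    rcases Nat.lt_or_eq_of_le hj with hj | rfl
    · have := dTail_le w j
      rcases hcl j hj with h | h <;> omega
    · omega
  have hdec : ∀ j₁ j₂ : ℕ, j₁ < j₂ → j₂ ≤ w.length →
      a j₁ ≤ desW w + 1 → a j₂ ≤ desW w + 1 → a j₂ < a j₁ := by
    intro j₁ j₂ h12 h2 b1 b2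
    have c1 := hcl j₁ (by omega)
    rcases Nat.lt_or_eq_of_le h2 with h2 | rfl
    · have t1 := dTail_anti w 0 j₁ (by omega) (by omega)
      rcases hcl j₂ h2 with ⟨e, rfl | ⟨m, rfl, em⟩⟩ | ⟨e, m, rfl, em⟩
      · omega
      · have t2 := dTail_anti w j₁ m (by omega) (by omega)
        omega
      · have t2 := dTail_anti w 0 m (by omega) (by omega)
        omega
    · omega
  have hinc : ∀ j₁ j₂ : ℕ, j₁ < j₂ → j₂ ≤ w.length →
      desW w + 2 ≤ a j₁ → desW w + 2 ≤ a j₂ → a j₁ < a j₂ := by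
    intro j₁ j₂ h12 h2 b1 b2
    have c1 := hcl j₁ (by omega)
    rcases Nat.lt_or_eq_of_le h2 with h2 | rfl
    · have t1 := dTail_anti w 0 j₁ (by omega) (by omega)
      have t3 := dTail_anti w 0 j₂ (by omega) (by omega)
      rcases hcl j₂ h2 with ⟨e, _⟩ | ⟨e, m, rfl, em⟩
      · omega
      · have t2 := dTail_anti w j₁ m (by omega) (by omega)
        omega
    · omega
  have hne : ∀ j₁ j₂ : ℕ, j₁ < j₂ → j₂ ≤ w.length → a j₁ ≠ a j₂ := by
    intro j₁ j₂ h12 h2 he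
    have := hdec j₁ j₂ h12 h2
    have := hinc j₁ j₂ h12 h2
    omega
  refine ⟨h0, hlast, ?_, hdec, hinc⟩
  have hinj : Set.InjOn a (Finset.range (w.length + 1)) := by
    intro x hx y hy hxy
    simp only [Finset.coe_range, Set.mem_Iio] at hx hy
    rcases lt_trichotomy x y with h | h | h
    · exact absurd hxy (hne x y h (by omega))
    · exact h
    · exact absurd hxy.symm (hne y x h (by omega))
  have himg : (Finset.range (w.length + 1)).image a = Finset.range (w.length + 1) := by
    apply Finset.eq_of_subset_of_card_le
    · intro v hv
      simp only [Finset.mem_image, Finset.mem_range] at hv ⊢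
      obtain ⟨j, hj, rfl⟩ := hv
      have := hle j (by omega)
      omega
    · rw [Finset.card_image_of_injOn hinj]
  intro v hv
  have hv' : v ∈ (Finset.range (w.length + 1)).image a := by
    rw [himg, Finset.mem_range]; omega
  obtain ⟨j, hj, rfl⟩ := Finset.mem_image.1 hv'
  rw [Finset.mem_range] at hj
  refine ⟨j, ⟨by omega, rfl⟩, ?_⟩
  rintro y ⟨hy, hyj⟩
  exact hinj (by simp; omega) (by simp; omega) hyj

end MoonPolyomino
end
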